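/- Let I be a square-free monomial ideal of R = K[x_1,…,x_r], let σ be a proper subset of {1,…,r}, let S = K[x_i : i ∉ σ], and let J = I R_σ ∩ S, where R_σ = R[x_i^{-1} : i ∈ σ]. Then reg(J^{(n)}) ≤ reg(I^{(n)}) for all n ≥ 1, and consequently δ(J) ≤ δ(I). -/

import Mathlib

open MvPolynomial Finset Filter

noncomputable section

/-- A family of potential faces (subsets of the vertex set `ι`). -/
abbrev FaceSet (ι : Type*) := Set (Finset ι)

/-- A face set is a simplicial complex if it is closed under taking subsets. -/
def IsSimplicialComplex {ι : Type*} (Δ : FaceSet ι) : Prop :=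
  ∀ σ ∈ Δ, ∀ τ : Finset ι, τ ⊆ σ → τ ∈ Δ

/-- The facets (maximal faces) of a face set. -/
def facets {ι : Type*} (Δ : FaceSet ι) : FaceSet ι :=
  {σ | σ ∈ Δ ∧ ∀ τ ∈ Δ, σ ⊆ τ → σ = τ}

/-- The Stanley–Reisner ideal of a simplicial complex: it is generated by the
square-free monomials corresponding to non-faces. -/
def srIdeal (K : Type*) [Field K] {ι : Type*} (Δ : FaceSet ι) :
    Ideal (MvPolynomial ι K) :=
  Ideal.span {p | ∃ τ : Finset ι, τ ∉ Δ ∧ p = ∏ i ∈ τ, X i}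

/-- The `n`-th symbolic power `I^{(n)} = ⋂_{p ∈ Min(I)} (Iⁿ R_p ∩ R)`. -/
def symbolicPower {R : Type*} [CommRing R] (I : Ideal R) (n : ℕ) : Ideal R :=
  ⨅ (p : Ideal R) (hp : p ∈ I.minimalPrimes),
    letI : p.IsPrime := hp.1.1
    (Ideal.map (algebraMap R (Localization.AtPrime p)) (I ^ n)).comap
      (algebraMap R (Localization.AtPrime p))

/-- The simplicial boundary operator on the space of chains (finitely supported
`K`-valued functions on finite subsets of `ι`), using the orientation coming
from the linear order of `ι`; a set of cardinality `d` is viewed as a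
`(d-1)`-dimensional simplex, the empty set accounting for the augmentation. -/
def bdry (K : Type*) [Field K] {ι : Type*} [LinearOrder ι] :
    (Finset ι →₀ K) →ₗ[K] (Finset ι →₀ K) :=
  Finsupp.lsum K fun σ => LinearMap.toSpanSingleton K _
    (∑ v ∈ σ, ((-1 : K) ^ (σ.filter fun w => w < v).card) • Finsupp.single (σ.erase v) (1 : K))

/-- The subspace of chains supported on the faces of `Δ` of cardinality `d`. -/
def cardFaces (K : Type*) [Field K] {ι : Type*} (Δ : FaceSet ι) (d : ℕ) :
    Submodule K (Finset ι →₀ K) :=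
  Submodule.span K {f | ∃ σ ∈ Δ, σ.card = d ∧ f = Finsupp.single σ (1 : K)}

/-- `H̃ⱼ(Δ; K) ≠ 0`: there is a cycle of cardinality-degree `j + 1` which is not
a boundary of a chain of `Δ`. -/
def HasNontrivialReducedHomology (K : Type*) [Field K] {ι : Type*} [LinearOrder ι]
    (Δ : FaceSet ι) (j : ℤ) : Prop :=
  ∃ d : ℕ, (d : ℤ) = j + 1 ∧
    ∃ z ∈ cardFaces K Δ d, bdry K z = 0 ∧ z ∉ ⇑(bdry K) '' ↑(cardFaces K Δ (d + 1))

/-- `G_α = {i : α_i < 0}`. -/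
def negSupport {ι : Type*} [Fintype ι] (α : ι → ℤ) : Finset ι :=
  Finset.univ.filter fun i => α i < 0

/-- The degree complex `Δ_α(I) = {F ⊆ [r] \ G_α : x^α ∉ I·R_F}` of Takayama, where
`x^α ∈ I·R_F` is expressed by saturation: `x^{α⁺}·(∏_{i ∈ F ∪ G_α} x_i)^m ∈ I` for some `m`. -/
def degreeComplex (K : Type*) [Field K] {ι : Type*} [Fintype ι] [LinearOrder ι]
    (I : Ideal (MvPolynomial ι K)) (α : ι → ℤ) : FaceSet ι :=
  {F | (∀ i ∈ F, 0 ≤ α i) ∧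
    ¬∃ m : ℕ,
      monomial (Finsupp.equivFunOnFinite.symm fun i => (α i).toNat) (1 : K) *
        (∏ i ∈ F ∪ negSupport α, X i) ^ m ∈ I}

/-- Nonvanishing of the graded piece `H_𝔪^i(R/I)_α` of local cohomology of a monomial
quotient, expressed via Takayama's formula
`dim_K H_𝔪^i(R/I)_α = dim_K H̃_{i-|G_α|-1}(Δ_α(I); K)`. -/
def lcNonzero (K : Type*) [Field K] {ι : Type*} [Fintype ι] [LinearOrder ι]
    (I : Ideal (MvPolynomial ι K)) (i : ℕ) (α : ι → ℤ) : Prop :=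
  HasNontrivialReducedHomology K (degreeComplex K I α) ((i : ℤ) - (negSupport α).card - 1)

/-- The `a_i`-invariant `a_i(R/I) = max{t : H_𝔪^i(R/I)_t ≠ 0}` of a monomial quotient
(`H_𝔪^i(R/I)_t = ⊕_{|α| = t} H_𝔪^i(R/I)_α`). -/
def aInv (K : Type*) [Field K] {ι : Type*} [Fintype ι] [LinearOrder ι]
    (I : Ideal (MvPolynomial ι K)) (i : ℕ) : ℤ :=
  sSup {z : ℤ | ∃ α : ι → ℤ, lcNonzero K I i α ∧ z = ∑ j, α j}

/-- The Castelnuovo–Mumford regularity `reg(R/I) = max_i (a_i(R/I) + i)` of a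
monomial quotient. -/
def regQuot (K : Type*) [Field K] {ι : Type*} [Fintype ι] [LinearOrder ι]
    (I : Ideal (MvPolynomial ι K)) : ℤ :=
  sSup {z : ℤ | ∃ (i : ℕ) (α : ι → ℤ), lcNonzero K I i α ∧ z = (∑ j, α j) + i}

/-- The Castelnuovo–Mumford regularity of a (monomial) ideal: `reg(I) = reg(R/I) + 1`. -/
def reg (K : Type*) [Field K] {ι : Type*} [Fintype ι] [LinearOrder ι]
    (I : Ideal (MvPolynomial ι K)) : ℤ :=
  regQuot K I + 1

/-- The depth `min{i : H_𝔪^i(R/I) ≠ 0}` of a monomial quotient. -/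
def depthQuot (K : Type*) [Field K] {ι : Type*} [Fintype ι] [LinearOrder ι]
    (I : Ideal (MvPolynomial ι K)) : ℕ :=
  sInf {i : ℕ | ∃ α : ι → ℤ, lcNonzero K I i α}

/-- The projective dimension `pd(R/I) = r - depth(R/I)` (Auslander–Buchsbaum). -/
def pdQuot (K : Type*) [Field K] {ι : Type*} [Fintype ι] [LinearOrder ι]
    (I : Ideal (MvPolynomial ι K)) : ℤ :=
  (Fintype.card ι : ℤ) - depthQuot K I

end
/-- The localization `R_σ = R[x_i^{-1} : i ∈ σ]`. -/
abbrev VarLocalization (K : Type*) [Field K] {r : ℕ} (σ : Finset (Fin r)) :=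
  Localization (Submonoid.closure {p : MvPolynomial (Fin r) K | ∃ i ∈ σ, p = X i})

/-- The polynomial subring `S = K[x_i : i ∉ σ]`. -/
abbrev SmallPolyRing (K : Type*) [Field K] {r : ℕ} (σ : Finset (Fin r)) :=
  MvPolynomial {i : Fin r // i ∉ σ} K

/-- The ideal `J = I·R_σ ∩ S` of `S = K[x_i : i ∉ σ]`. -/
noncomputable def restrictedIdeal (K : Type*) [Field K] {r : ℕ} (σ : Finset (Fin r))
    (I : Ideal (MvPolynomial (Fin r) K)) : Ideal (SmallPolyRing K σ) :=
  Ideal.comap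
    ((algebraMap (MvPolynomial (Fin r) K) (VarLocalization K σ)).comp
      (MvPolynomial.rename (Subtype.val : {i : Fin r // i ∉ σ} → Fin r)).toRingHom)
    (Ideal.map (algebraMap (MvPolynomial (Fin r) K) (VarLocalization K σ)) I)

theorem bdry_single (K : Type*) [Field K] {ι : Type*} [LinearOrder ι] (σ : Finset ι) :
    bdry K (Finsupp.single σ 1) =
      ∑ v ∈ σ, ((-1 : K) ^ (σ.filter fun w => w < v).card) •
        Finsupp.single (σ.erase v) (1 : K) := by
  simp [bdry]

/-- The cone operator with apex `j`, sending a face `σ` not containing `j` to `± σ ∪ {j}`. -/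
noncomputable def coneOp (K : Type*) [Field K] {ι : Type*} [LinearOrder ι] (j : ι) :
    (Finset ι →₀ K) →ₗ[K] (Finset ι →₀ K) :=
  Finsupp.lsum K fun σ => LinearMap.toSpanSingleton K _
    (if j ∈ σ then 0 else
      ((-1 : K) ^ (σ.filter fun w => w < j).card) • Finsupp.single (insert j σ) (1 : K))

theorem coneOp_single (K : Type*) [Field K] {ι : Type*} [LinearOrder ι] (j : ι)
    (σ : Finset ι) :
    coneOp K j (Finsupp.single σ 1) = if j ∈ σ then 0 else
      ((-1 : K) ^ (σ.filter fun w => w < j).card) • Finsupp.single (insert j σ) (1 : K) := by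
  simp [coneOp]

theorem bdry_coneOp_add_single (K : Type*) [Field K] {ι : Type*} [LinearOrder ι] (j : ι)
    (σ : Finset ι) :
    bdry K (coneOp K j (Finsupp.single σ 1)) + coneOp K j (bdry K (Finsupp.single σ 1)) =
      Finsupp.single σ 1 := by
  rw [bdry_single, coneOp_single, map_sum]
  by_cases hj : j ∈ σ
  · rw [if_pos hj, map_zero, zero_add, Finset.sum_eq_single_of_mem j hj]
    · rw [map_smul, coneOp_single, if_neg (by simp), Finset.insert_erase hj, smul_smul, ← pow_add]
      have : ((σ.erase j).filter fun w => w < j) = σ.filter fun w => w < j := by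
        ext w
        simp only [Finset.mem_filter, Finset.mem_erase]
        exact ⟨fun h => ⟨h.1.2, h.2⟩, fun h => ⟨⟨h.2.ne, h.1⟩, h.2⟩⟩
      rw [this, Even.neg_one_pow ⟨_, rfl⟩, one_smul]
    · intro v _ hvj
      rw [map_smul, coneOp_single, if_pos (by simp [hj, hvj.symm]), smul_zero]
  · rw [if_neg hj, map_smul, bdry_single, Finset.sum_insert hj, smul_add, smul_smul, ← pow_add]
    have hfj : ((insert j σ).filter fun w => w < j) = σ.filter fun w => w < j := by
      rw [Finset.filter_insert, if_neg (lt_irrefl j)]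
    rw [hfj, Even.neg_one_pow ⟨_, rfl⟩, one_smul, Finset.erase_insert hj, add_assoc,
      Finset.smul_sum, ← Finset.sum_add_distrib, Finset.sum_eq_zero, add_zero]
    intro v hv
    have hvj : v ≠ j := fun h => hj (h ▸ hv)
    have hje : j ∉ σ.erase v := fun h => hj (Finset.mem_of_mem_erase h)
    rw [map_smul, coneOp_single, if_neg hje, smul_smul, smul_smul, ← pow_add, ← pow_add,
      Finset.erase_insert_of_ne hvj.symm, ← add_smul]
    rcases lt_or_gt_of_ne hvj with h | h
    · have h1 : ((insert j σ).filter fun w => w < v) = σ.filter fun w => w < v := by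
        rw [Finset.filter_insert, if_neg (not_lt.2 h.le)]
      have h2 : (σ.filter fun w => w < j).card =
          ((σ.erase v).filter fun w => w < j).card + 1 := by
        rw [Finset.filter_erase, Finset.card_erase_add_one (by simp [hv, h])]
      rw [h1, h2]
      convert zero_smul K _ using 2
      ring
    · have h1 : ((insert j σ).filter fun w => w < v).card =
          (σ.filter fun w => w < v).card + 1 := by
        rw [Finset.filter_insert, if_pos h, Finset.card_insert_of_notMem (by simp [hj])]
      have h2 : ((σ.erase v).filter fun w => w < j) = σ.filter fun w => w < j := by
        rw [Finset.filter_erase, Finset.erase_eq_of_notMem (by simp [h.le])]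
      rw [h1, h2]
      convert zero_smul K _ using 2
      ring

theorem bdry_coneOp_add (K : Type*) [Field K] {ι : Type*} [LinearOrder ι] (j : ι)
    (z : Finset ι →₀ K) :
    bdry K (coneOp K j z) + coneOp K j (bdry K z) = z := by
  have h : bdry K ∘ₗ coneOp K j + coneOp K j ∘ₗ bdry K = LinearMap.id :=
    Finsupp.lhom_ext' fun σ => LinearMap.ext_ring (by
      simpa using bdry_coneOp_add_single K j σ)
  exact LinearMap.congr_fun h z

theorem coneOp_mem_cardFaces (K : Type*) [Field K] {ι : Type*} [LinearOrder ι]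
    {Δ : FaceSet ι} {j : ι} (hΔ : ∀ F ∈ Δ, insert j F ∈ Δ) {d : ℕ} {z : Finset ι →₀ K}
    (hz : z ∈ cardFaces K Δ d) : coneOp K j z ∈ cardFaces K Δ (d + 1) := by
  refine (Submodule.span_le (p := (cardFaces K Δ (d + 1)).comap (coneOp K j))).2 ?_ hz
  rintro _ ⟨σ, hσ, hd, rfl⟩
  rw [SetLike.mem_coe, Submodule.mem_comap, coneOp_single]
  split_ifs with hj
  · exact zero_mem _
  · exact Submodule.smul_mem _ _ (Submodule.subset_span
      ⟨_, hΔ σ hσ, by rw [Finset.card_insert_of_notMem hj, hd], rfl⟩)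

/-- Cones have no reduced homology. -/
theorem not_hasNontrivialReducedHomology_of_cone (K : Type*) [Field K] {ι : Type*}
    [LinearOrder ι] {Δ : FaceSet ι} {j : ι} (hΔ : ∀ F ∈ Δ, insert j F ∈ Δ) (k : ℤ) :
    ¬HasNontrivialReducedHomology K Δ k := by
  rintro ⟨d, -, z, hz, hz0, hzb⟩
  refine hzb ⟨coneOp K j z, coneOp_mem_cardFaces K hΔ hz, ?_⟩
  simpa [hz0] using bdry_coneOp_add K j z

theorem HasNontrivialReducedHomology.le_card {K : Type*} [Field K] {ι : Type*} [Fintype ι]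
    [LinearOrder ι] {Δ : FaceSet ι} {k : ℤ} (h : HasNontrivialReducedHomology K Δ k) :
    k + 1 ≤ Fintype.card ι := by
  obtain ⟨d, hd, z, hz, -, hzb⟩ := h
  by_contra hlt
  have hbot : cardFaces K Δ d = ⊥ := by
    refine Submodule.span_eq_bot.2 ?_
    rintro _ ⟨σ, -, hc, -⟩
    have := σ.card_le_univ
    omega
  rw [hbot, Submodule.mem_bot] at hz
  exact hzb ⟨0, zero_mem _, by rw [hz, map_zero]⟩

theorem bdry_mapDomain_map (K : Type*) [Field K] {ι κ : Type*} [LinearOrder ι] [LinearOrder κ]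
    {e : ι ↪ κ} (he : StrictMono e) (z : Finset ι →₀ K) :
    bdry K (Finsupp.mapDomain (Finset.map e) z) =
      Finsupp.mapDomain (Finset.map e) (bdry K z) := by
  have h : bdry K ∘ₗ Finsupp.lmapDomain K K (Finset.map e) =
      Finsupp.lmapDomain K K (Finset.map e) ∘ₗ bdry K := by
    refine Finsupp.lhom_ext' fun σ => LinearMap.ext_ring ?_
    simp only [LinearMap.comp_apply, Finsupp.lsingle_apply, Finsupp.lmapDomain_apply,
      Finsupp.mapDomain_single]
    rw [bdry_single, bdry_single, Finset.sum_map, ← Finsupp.lmapDomain_apply K K, map_sum]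
    refine Finset.sum_congr rfl fun v _ => ?_
    rw [map_smul, Finsupp.lmapDomain_apply, Finsupp.mapDomain_single, Finset.map_erase,
      Finset.filter_map, Finset.card_map]
    simp [he.lt_iff_lt]
  exact LinearMap.congr_fun h z

theorem cardFaces_image_map (K : Type*) [Field K] {ι κ : Type*} (e : ι ↪ κ) (Δ : FaceSet ι)
    (d : ℕ) :
    cardFaces K (Finset.map e '' Δ) d =
      (cardFaces K Δ d).map (Finsupp.lmapDomain K K (Finset.map e)) := by
  rw [cardFaces, cardFaces, Submodule.map_span]
  congr 1
  ext f
  constructor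
  · rintro ⟨_, ⟨σ, hσ, rfl⟩, hd, rfl⟩
    exact ⟨_, ⟨σ, hσ, by simpa using hd, rfl⟩, by simp⟩
  · rintro ⟨_, ⟨σ, hσ, hd, rfl⟩, rfl⟩
    exact ⟨_, ⟨σ, hσ, rfl⟩, by simpa using hd, by simp⟩

theorem HasNontrivialReducedHomology.image_map {K : Type*} [Field K] {ι κ : Type*}
    [LinearOrder ι] [LinearOrder κ] {e : ι ↪ κ} (he : StrictMono e) {Δ : FaceSet ι} {k : ℤ}
    (h : HasNontrivialReducedHomology K Δ k) :
    HasNontrivialReducedHomology K (Finset.map e '' Δ) k := by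
  obtain ⟨d, hd, z, hz, hz0, hzb⟩ := h
  refine ⟨d, hd, Finsupp.mapDomain (Finset.map e) z, ?_, ?_, ?_⟩
  · rw [cardFaces_image_map]
    exact ⟨z, hz, rfl⟩
  · rw [bdry_mapDomain_map K he, hz0, Finsupp.mapDomain_zero]
  · rw [cardFaces_image_map]
    rintro ⟨_, ⟨y, hy, rfl⟩, hyz⟩
    refine hzb ⟨y, hy, Finsupp.mapDomain_injective (Finset.map_injective e) ?_⟩
    rw [← hyz, Finsupp.lmapDomain_apply, bdry_mapDomain_map K he]

/-- The complex `{∅}` has nonzero reduced homology in degree `-1`. -/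
theorem hasNontrivialReducedHomology_singleton_empty (K : Type*) [Field K] {ι : Type*}
    [LinearOrder ι] : HasNontrivialReducedHomology K ({∅} : FaceSet ι) (-1) := by
  refine ⟨0, by simp, Finsupp.single ∅ 1, Submodule.subset_span ⟨∅, rfl, rfl, rfl⟩,
    by simp [bdry_single], ?_⟩
  have hbot : cardFaces K ({∅} : FaceSet ι) (0 + 1) = ⊥ := by
    refine Submodule.span_eq_bot.2 ?_
    rintro _ ⟨σ, rfl, hc, -⟩
    simp at hc
  rw [hbot]
  simp

theorem exists_pow_mul_mem_stable {A : Type*} [CommRing A] [IsNoetherianRing A] (I : Ideal A)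
    (x : A) : ∃ ρ : ℕ, ∀ (k : ℕ) (f : A), x ^ k * f ∈ I → x ^ ρ * f ∈ I := by
  let c : ℕ →o Submodule A A :=
    { toFun := fun n => Submodule.comap (LinearMap.mulLeft A (x ^ n)) I
      monotone' := by
        intro m n hmn f hf
        obtain ⟨k, rfl⟩ := Nat.exists_eq_add_of_le' hmn
        have h : x ^ m * f ∈ I := hf
        change x ^ (k + m) * f ∈ I
        rw [pow_add, mul_assoc]
        exact I.mul_mem_left _ h }
  obtain ⟨ρ, hρ⟩ := monotone_stabilizes_iff_noetherian.2 inferInstance c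
  refine ⟨ρ, fun k f hf => ?_⟩
  have h1 : f ∈ c (k + ρ) := c.monotone (Nat.le_add_right k ρ) hf
  rw [← hρ (k + ρ) (Nat.le_add_left ρ k)] at h1
  exact h1

theorem bddAbove_regQuot_set (K : Type*) [Field K] {ι : Type*} [Fintype ι] [LinearOrder ι]
    (I : Ideal (MvPolynomial ι K)) :
    BddAbove {z : ℤ | ∃ (i : ℕ) (α : ι → ℤ), lcNonzero K I i α ∧ z = (∑ j, α j) + i} := by
  choose ρ hρ using fun j : ι => exists_pow_mul_mem_stable I (X j : MvPolynomial ι K)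
  refine ⟨(∑ j, (ρ j : ℤ)) + 2 * Fintype.card ι, ?_⟩
  rintro _ ⟨i, α, hα, rfl⟩
  have hle : ∀ j, α j ≤ ρ j := by
    intro j
    by_contra! hj
    refine not_hasNontrivialReducedHomology_of_cone K (j := j) ?_ _ hα
    rintro F ⟨hF, hFI⟩
    by_cases hjF : j ∈ F
    · rw [Finset.insert_eq_of_mem hjF]
      exact ⟨hF, hFI⟩
    refine ⟨fun i hi => ?_, ?_⟩
    · rcases Finset.mem_insert.1 hi with rfl | hi
      · omega
      · exact hF i hi
    · rintro ⟨m, hm⟩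
      refine hFI ⟨m, ?_⟩
      have hjG : j ∉ F ∪ negSupport α := by
        simp only [negSupport, Finset.mem_union, Finset.mem_filter, Finset.mem_univ, true_and]
        rintro (h | h)
        · exact hjF h
        · omega
      obtain ⟨q, hq⟩ : (X j : MvPolynomial ι K) ^ ρ j ∣
          monomial (Finsupp.equivFunOnFinite.symm fun i => (α i).toNat) (1 : K) := by
        rw [X_pow_eq_monomial, monomial_dvd_monomial]
        refine ⟨Or.inr ?_, dvd_rfl⟩
        rw [Finsupp.single_le_iff]
        change ρ j ≤ (α j).toNat
        omega
      rw [hq, Finset.insert_union, Finset.prod_insert hjG] at hm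
      rw [hq, mul_assoc]
      refine hρ j (ρ j + m) _ ?_
      convert hm using 1
      ring
  have hsum : ∑ j, α j ≤ ∑ j, (ρ j : ℤ) := Finset.sum_le_sum fun j _ => hle j
  have hc := HasNontrivialReducedHomology.le_card hα
  have hG := (negSupport α).card_le_univ
  omega

theorem exists_lcNonzero_sum_eq_zero (K : Type*) [Field K] {ι : Type*} [Fintype ι]
    [LinearOrder ι] {I : Ideal (MvPolynomial ι K)} (hI : I ≠ ⊤) :
    ∃ (i : ℕ) (α : ι → ℤ), lcNonzero K I i α ∧ 0 = (∑ j, α j) + i := by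
  obtain ⟨F, hF⟩ := (Set.toFinite {F : Finset ι | ∀ m : ℕ,
    (∏ i ∈ F, (X i : MvPolynomial ι K)) ^ m ∉ I}).exists_maximal
    ⟨∅, fun m => by simpa using (Ideal.ne_top_iff_one I).1 hI⟩
  have hneg : negSupport (fun i => if i ∈ F then (-1 : ℤ) else 0) = F := by
    ext i
    by_cases h : i ∈ F <;> simp [negSupport, h]
  refine ⟨F.card, fun i => if i ∈ F then -1 else 0, ?_, by simp⟩
  have hexp : (Finsupp.equivFunOnFinite.symm fun i =>
      (if i ∈ F then (-1 : ℤ) else 0).toNat) = 0 := by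
    ext i
    by_cases h : i ∈ F <;> simp [h]
  have hmono : (monomial (Finsupp.equivFunOnFinite.symm fun i =>
      (if i ∈ F then (-1 : ℤ) else 0).toNat) (1 : K) : MvPolynomial ι K) = 1 := by
    rw [hexp, monomial_zero', C_1]
  have hΔ : degreeComplex K I (fun i => if i ∈ F then (-1 : ℤ) else 0) = {∅} := by
    ext F'
    simp only [degreeComplex, hneg, hmono, one_mul, Set.mem_ofPred_eq, Set.mem_singleton_iff,
      not_exists]
    constructor
    · rintro ⟨h0, hm⟩
      refine Finset.eq_empty_of_forall_notMem fun i hi => ?_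
      have hiF : i ∈ F := hF.2 (show F' ∪ F ∈ _ from hm) Finset.subset_union_right
        (Finset.mem_union_left _ hi)
      simpa [hiF] using h0 i hi
    · rintro rfl
      exact ⟨by simp, by simpa using hF.1⟩
  rw [lcNonzero, hΔ, hneg, sub_self, zero_sub]
  exact hasNontrivialReducedHomology_singleton_empty K

theorem regQuot_nonneg (K : Type*) [Field K] {ι : Type*} [Fintype ι] [LinearOrder ι]
    (I : Ideal (MvPolynomial ι K)) : 0 ≤ regQuot K I := by
  by_cases hI : I = ⊤
  · rw [regQuot]
    have hempty : ∀ (i : ℕ) (α : ι → ℤ), ¬lcNonzero K I i α := by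
      rintro i α ⟨d, -, z, hz, -, hzb⟩
      have hbot : cardFaces K (degreeComplex K I α) d = ⊥ := by
        refine Submodule.span_eq_bot.2 ?_
        rintro _ ⟨σ, ⟨-, hσ⟩, -⟩
        exact absurd ⟨0, by simp [hI]⟩ hσ
      rw [hbot, Submodule.mem_bot] at hz
      exact hzb ⟨0, zero_mem _, by rw [hz, map_zero]⟩
    simp [hempty]
  · exact le_csSup (bddAbove_regQuot_set K I) (exists_lcNonzero_sum_eq_zero K hI)

/-- It suffices to compare degree by degree for comparing regularities. -/
theorem reg_le_reg_of_lcNonzero (K : Type*) [Field K] {ι κ : Type*} [Fintype ι] [LinearOrder ι]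
    [Fintype κ] [LinearOrder κ] {J : Ideal (MvPolynomial ι K)} {I : Ideal (MvPolynomial κ K)}
    (h : ∀ (i : ℕ) (α : ι → ℤ), lcNonzero K J i α →
      ∃ (i' : ℕ) (β : κ → ℤ), lcNonzero K I i' β ∧ (∑ j, α j) + i = (∑ j, β j) + i') :
    reg K J ≤ reg K I := by
  refine add_le_add_left ?_ 1
  rcases Set.eq_empty_or_nonempty {z : ℤ | ∃ (i : ℕ) (α : ι → ℤ),
    lcNonzero K J i α ∧ z = (∑ j, α j) + i} with he | hne
  · rw [regQuot, he, Int.csSup_empty]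
    exact regQuot_nonneg K I
  · refine csSup_le_csSup (bddAbove_regQuot_set K I) hne ?_
    rintro _ ⟨i, α, hα, rfl⟩
    exact h i α hα

theorem mem_symbolicPower {A : Type*} [CommRing A] {I : Ideal A} {n : ℕ} {f : A} :
    f ∈ symbolicPower I n ↔ ∀ p ∈ I.minimalPrimes, ∃ s ∉ p, s * f ∈ I ^ n := by
  simp only [symbolicPower, Submodule.mem_iInf]
  refine forall₂_congr fun p hp => ?_
  have : p.IsPrime := hp.1.1
  rw [Ideal.mem_comap, IsLocalization.algebraMap_mem_map_algebraMap_iff p.primeCompl]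
  rfl

theorem exists_mul_pow_mem_of_mem_minimalPrimes {A : Type*} [CommRing A] {I p : Ideal A}
    (hp : p ∈ I.minimalPrimes) {w : A} (hw : w ∈ p) : ∃ s ∉ p, ∃ k : ℕ, s * w ^ k ∈ I := by
  have := hp.1.1
  by_contra! h
  obtain ⟨q, hq, hIq, hqd⟩ := Ideal.exists_le_prime_disjoint I
    (p.primeCompl ⊔ Submonoid.powers w) (Set.disjoint_left.2 fun x hxI hx => by
      obtain ⟨s, hs, _, ⟨k, rfl⟩, rfl⟩ := Submonoid.mem_sup.1 hx
      exact h s hs k hxI)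
  have hqp : q ≤ p := fun x hx => by
    by_contra hxp
    exact Set.disjoint_left.1 hqd hx ((le_sup_left : _ ≤ p.primeCompl ⊔ _) hxp)
  exact Set.disjoint_left.1 hqd (hp.2 ⟨hq, hIq⟩ hqp hw)
    ((le_sup_right : _ ≤ p.primeCompl ⊔ _) (Submonoid.mem_powers w))

section PolynomialExtension

variable {S A τ : Type*} [CommRing S] [CommRing A] {f : S →+* A} {e : A ≃+* MvPolynomial τ S}

theorem mem_map_iff_coeff_mem (he : ∀ g, e (f g) = C g) {q : Ideal S} {x : A} :
    x ∈ q.map f ↔ ∀ m, coeff m (e x) ∈ q := by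
  have hef : (e : A →+* MvPolynomial τ S).comp f = C := RingHom.ext he
  rw [← mem_map_C_iff, ← hef, ← Ideal.map_map]
  exact (Ideal.apply_mem_of_equiv_iff (f := e)).symm

theorem apply_mem_map_iff (he : ∀ g, e (f g) = C g) {q : Ideal S} {g : S} :
    f g ∈ q.map f ↔ g ∈ q := by
  refine ⟨fun h => ?_, Ideal.mem_map_of_mem f⟩
  simpa [he] using (mem_map_iff_coeff_mem he).1 h 0

theorem isPrime_map_of_polynomialExtension (he : ∀ g, e (f g) = C g) {q : Ideal S}
    (hq : q.IsPrime) : (q.map f).IsPrime := by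
  have h : q.map f = RingHom.ker
      ((MvPolynomial.map (σ := τ) (Ideal.Quotient.mk q)).comp (e : A →+* MvPolynomial τ S)) := by
    ext x
    rw [mem_map_iff_coeff_mem he, RingHom.mem_ker, MvPolynomial.ext_iff]
    simp [coeff_map, Ideal.Quotient.eq_zero_iff_mem]
  rw [h]
  exact RingHom.ker_isPrime _

variable {I : Ideal A} {J : Ideal S} {W : Submonoid A}

theorem le_comap_of_disjoint (hJ : ∀ g, g ∈ J ↔ ∃ w ∈ W, w * f g ∈ I) {p : Ideal A}
    (hp : p.IsPrime) (hIp : I ≤ p) (hpW : ∀ w ∈ W, w ∉ p) : J ≤ p.comap f := by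
  intro g hg
  obtain ⟨w, hw, hwg⟩ := (hJ g).1 hg
  exact (hp.mem_or_mem (hIp hwg)).resolve_left (hpW w hw)

theorem map_mem_minimalPrimes (he : ∀ g, e (f g) = C g)
    (hJ : ∀ g, g ∈ J ↔ ∃ w ∈ W, w * f g ∈ I) (hIJ : I ≤ J.map f)
    (hW : ∀ q : Ideal S, q.IsPrime → ∀ w ∈ W, w ∉ q.map f) {q : Ideal S}
    (hq : q ∈ J.minimalPrimes) : q.map f ∈ I.minimalPrimes := by
  refine ⟨⟨isPrime_map_of_polynomialExtension he hq.1.1, hIJ.trans (Ideal.map_mono hq.1.2)⟩, ?_⟩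
  rintro p ⟨hp, hIp⟩ hpq
  rw [Ideal.map_le_iff_le_comap]
  refine hq.2 ⟨hp.comap f, le_comap_of_disjoint hJ hp hIp fun w hw hwp =>
    hW q hq.1.1 w hw (hpq hwp)⟩ fun g hg => (apply_mem_map_iff he).1 (hpq hg)

theorem comap_mem_minimalPrimes (he : ∀ g, e (f g) = C g)
    (hJ : ∀ g, g ∈ J ↔ ∃ w ∈ W, w * f g ∈ I) (hIJ : I ≤ J.map f) {p : Ideal A}
    (hp : p ∈ I.minimalPrimes) (hpW : ∀ w ∈ W, w ∉ p) : p.comap f ∈ J.minimalPrimes := by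
  refine ⟨⟨hp.1.1.comap f, le_comap_of_disjoint hJ hp.1.1 hp.1.2 hpW⟩, ?_⟩
  rintro q ⟨hq, hJq⟩ hqp g hg
  exact (apply_mem_map_iff he).1 (hp.2 ⟨isPrime_map_of_polynomialExtension he hq,
    hIJ.trans (Ideal.map_mono hJq)⟩ (Ideal.map_le_iff_le_comap.2 hqp) hg)

theorem exists_mul_apply_mem_pow (hJ : ∀ g, g ∈ J ↔ ∃ w ∈ W, w * f g ∈ I) {n : ℕ} {g : S}
    (hg : g ∈ J ^ n) : ∃ w ∈ W, w * f g ∈ I ^ n := by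
  have hJI : J.map ((algebraMap A (Localization W)).comp f) ≤
      I.map (algebraMap A (Localization W)) := by
    rw [Ideal.map_le_iff_le_comap]
    exact fun g hg => (IsLocalization.algebraMap_mem_map_algebraMap_iff W _ I (f g)).2
      ((hJ g).1 hg)
  have h := Ideal.pow_right_mono hJI n (by
    rw [← Ideal.map_pow]
    exact Ideal.mem_map_of_mem _ hg)
  rw [← Ideal.map_pow] at h
  exact (IsLocalization.algebraMap_mem_map_algebraMap_iff W _ (I ^ n) (f g)).1 h

/-- Symbolic powers commute with localizing at `W` and contracting along a polynomial
extension. -/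
theorem mem_symbolicPower_iff_exists_mul_mem [IsNoetherianRing A] (he : ∀ g, e (f g) = C g)
    (hJ : ∀ g, g ∈ J ↔ ∃ w ∈ W, w * f g ∈ I) (hIJ : I ≤ J.map f)
    (hW : ∀ q : Ideal S, q.IsPrime → ∀ w ∈ W, w ∉ q.map f) {n : ℕ} {g : S} :
    g ∈ symbolicPower J n ↔ ∃ w ∈ W, w * f g ∈ symbolicPower I n := by
  simp only [mem_symbolicPower]
  constructor
  · intro hg
    have hloc : ∀ p : I.minimalPrimes, ∃ w ∈ W, ∃ s ∉ p.1, s * (w * f g) ∈ I ^ n := by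
      rintro ⟨p, hp⟩
      have hpp : p.IsPrime := hp.1.1
      by_cases hpW : ∀ w ∈ W, w ∉ p
      · obtain ⟨t, ht, htg⟩ := hg _ (comap_mem_minimalPrimes he hJ hIJ hp hpW)
        obtain ⟨w, hw, hwt⟩ := exists_mul_apply_mem_pow hJ htg
        refine ⟨1, W.one_mem, w * f t, fun h => (hpp.mem_or_mem h).elim (hpW w hw) ht, ?_⟩
        rwa [one_mul, mul_assoc, ← map_mul]
      · push Not at hpW
        obtain ⟨w, hw, hwp⟩ := hpW
        obtain ⟨s, hs, k, hsk⟩ := exists_mul_pow_mem_of_mem_minimalPrimes hp hwp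
        refine ⟨(w ^ k) ^ n, pow_mem (pow_mem hw k) n, s ^ n,
          fun h => hs (hpp.mem_of_pow_mem n h), ?_⟩
        rw [← mul_assoc, ← mul_pow]
        exact Ideal.mul_mem_right _ _ (Ideal.pow_mem_pow hsk n)
    choose w hw s hs hws using hloc
    have : Fintype I.minimalPrimes := (Ideal.finite_minimalPrimes_of_isNoetherianRing A I).fintype
    refine ⟨∏ p, w p, prod_mem fun p _ => hw p, fun p hp => ⟨s ⟨p, hp⟩, hs ⟨p, hp⟩, ?_⟩⟩
    obtain ⟨c, hc⟩ := Finset.dvd_prod_of_mem w (Finset.mem_univ ⟨p, hp⟩)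
    have := Ideal.mul_mem_left _ c (hws ⟨p, hp⟩)
    rw [hc]
    convert this using 1
    ring
  · rintro ⟨w, hw, hwg⟩ q hq
    obtain ⟨s, hs, hsg⟩ := hwg _ (map_mem_minimalPrimes he hJ hIJ hW hq)
    have hprime := isPrime_map_of_polynomialExtension he hq.1.1
    have hsw : s * w ∉ q.map f := fun h => (hprime.mem_or_mem h).elim hs (hW q hq.1.1 w hw)
    rw [mem_map_iff_coeff_mem he] at hsw
    push Not at hsw
    obtain ⟨m, hm⟩ := hsw
    refine ⟨_, hm, ?_⟩
    have h := Ideal.pow_right_mono hIJ n hsg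
    rw [← Ideal.map_pow, mem_map_iff_coeff_mem he] at h
    have hm := h m
    rwa [← mul_assoc, map_mul e, he, mul_comm, coeff_C_mul, mul_comm] at hm

end PolynomialExtension

theorem exists_ringEquiv_rename_eq_C (K : Type*) [Field K] {r : ℕ} (σ : Finset (Fin r)) :
    ∃ e : MvPolynomial (Fin r) K ≃+* MvPolynomial {i // i ∈ σ} (SmallPolyRing K σ),
      (∀ g : SmallPolyRing K σ, e (rename Subtype.val g) = C g) ∧
        ∀ i : {i // i ∈ σ}, e (X i) = X i := by
  let e : MvPolynomial (Fin r) K ≃ₐ[K] MvPolynomial {i // i ∈ σ} (SmallPolyRing K σ) :=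
    (renameEquiv K (Equiv.sumCompl (· ∈ σ))).symm.trans
      (sumAlgEquiv K {i // i ∈ σ} {i // i ∉ σ})
  refine ⟨e.toRingEquiv, fun g => ?_, fun i => ?_⟩
  · have h : e.toAlgHom.comp (rename Subtype.val) =
        IsScalarTower.toAlgHom K (SmallPolyRing K σ)
          (MvPolynomial {i // i ∈ σ} (SmallPolyRing K σ)) := by
      ext1 i
      simp [e, Equiv.sumCompl_symm_apply_of_neg i.2]
    exact DFunLike.congr_fun h g
  · simp [e, Equiv.sumCompl_symm_apply_of_pos i.2]

theorem mem_restrictedIdeal {K : Type*} [Field K] {r : ℕ} {σ : Finset (Fin r)}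
    {I : Ideal (MvPolynomial (Fin r) K)} (g : SmallPolyRing K σ) :
    g ∈ restrictedIdeal K σ I ↔
      ∃ w ∈ Submonoid.closure {p : MvPolynomial (Fin r) K | ∃ i ∈ σ, p = X i},
        w * rename Subtype.val g ∈ I :=
  IsLocalization.algebraMap_mem_map_algebraMap_iff _ (VarLocalization K σ) I _

theorem prod_X_mem_closure {K : Type*} [Field K] {r : ℕ} {σ τ : Finset (Fin r)} (h : τ ⊆ σ) :
    ∏ i ∈ τ, X i ∈ Submonoid.closure {p : MvPolynomial (Fin r) K | ∃ i ∈ σ, p = X i} :=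
  prod_mem fun i hi => Submonoid.subset_closure ⟨i, h hi, rfl⟩

theorem exists_dvd_prod_X_pow {K : Type*} [Field K] {r : ℕ} {σ : Finset (Fin r)}
    {w : MvPolynomial (Fin r) K}
    (hw : w ∈ Submonoid.closure {p : MvPolynomial (Fin r) K | ∃ i ∈ σ, p = X i}) :
    ∃ k : ℕ, w ∣ (∏ i ∈ σ, X i) ^ k := by
  induction hw using Submonoid.closure_induction with
  | mem x hx =>
    obtain ⟨i, hi, rfl⟩ := hx
    exact ⟨1, by simpa using Finset.dvd_prod_of_mem _ hi⟩
  | one => exact ⟨0, one_dvd _⟩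
  | mul x y _ _ hx hy =>
    obtain ⟨a, ha⟩ := hx
    obtain ⟨b, hb⟩ := hy
    exact ⟨a + b, by simpa [pow_add] using mul_dvd_mul ha hb⟩

theorem exists_mul_pow_mem_iff_exists_closure {K : Type*} [Field K] {r : ℕ}
    {σ : Finset (Fin r)} {I : Ideal (MvPolynomial (Fin r) K)} {u P : MvPolynomial (Fin r) K} :
    (∃ m : ℕ, u * (P ^ m * (∏ i ∈ σ, X i) ^ m) ∈ I) ↔
      ∃ m : ℕ, ∃ w ∈ Submonoid.closure {p : MvPolynomial (Fin r) K | ∃ i ∈ σ, p = X i},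
        w * (u * P ^ m) ∈ I := by
  constructor
  · rintro ⟨m, hm⟩
    refine ⟨m, _, pow_mem (prod_X_mem_closure (Finset.Subset.refl σ)) m, ?_⟩
    convert hm using 1
    ring
  · rintro ⟨m, w, hw, hwm⟩
    obtain ⟨k, c, hc⟩ := exists_dvd_prod_X_pow hw
    refine ⟨m + k, ?_⟩
    convert Ideal.mul_mem_left _ (c * P ^ k * (∏ i ∈ σ, X i) ^ m) hwm using 1
    rw [pow_add _ m k, pow_add _ m k, hc]
    ring

theorem srIdeal_le_map_restrictedIdeal (K : Type*) [Field K] {r : ℕ} (σ : Finset (Fin r))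
    (Δ : FaceSet (Fin r)) :
    srIdeal K Δ ≤ (restrictedIdeal K σ (srIdeal K Δ)).map
      (rename (Subtype.val : {i : Fin r // i ∉ σ} → Fin r) : _ →ₐ[K] _).toRingHom := by
  refine Ideal.span_le.2 ?_
  rintro _ ⟨τ, hτ, rfl⟩
  have hren : rename Subtype.val (∏ i ∈ τ.subtype (· ∉ σ), X i : SmallPolyRing K σ) =
      ∏ i ∈ τ with i ∉ σ, (X i : MvPolynomial (Fin r) K) := by
    rw [map_prod, ← Finset.prod_subtype_eq_prod_filter]
    simp
  have hsplit := Finset.prod_filter_mul_prod_filter_not τ (· ∈ σ)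
    (fun i => (X i : MvPolynomial (Fin r) K))
  rw [SetLike.mem_coe, ← hsplit, ← hren]
  refine Ideal.mul_mem_left _ _ (Ideal.mem_map_of_mem (rename Subtype.val : _ →ₐ[K] _).toRingHom
    ((mem_restrictedIdeal _).2 ⟨∏ i ∈ τ with i ∈ σ, X i,
      prod_X_mem_closure fun i hi => (Finset.mem_filter.1 hi).2, ?_⟩))
  rw [hren, hsplit]
  exact Ideal.subset_span ⟨τ, hτ, rfl⟩

theorem mem_symbolicPower_restrictedIdeal {K : Type*} [Field K] {r : ℕ} {σ : Finset (Fin r)}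
    {Δ : FaceSet (Fin r)} {n : ℕ} {g : SmallPolyRing K σ} :
    g ∈ symbolicPower (restrictedIdeal K σ (srIdeal K Δ)) n ↔
      ∃ w ∈ Submonoid.closure {p : MvPolynomial (Fin r) K | ∃ i ∈ σ, p = X i},
        w * rename Subtype.val g ∈ symbolicPower (srIdeal K Δ) n := by
  obtain ⟨e, he, heX⟩ := exists_ringEquiv_rename_eq_C K σ
  refine mem_symbolicPower_iff_exists_mul_mem
    (f := (rename (Subtype.val : {i : Fin r // i ∉ σ} → Fin r) : _ →ₐ[K] _).toRingHom)
    he mem_restrictedIdeal (srIdeal_le_map_restrictedIdeal K σ Δ) fun q hq w hw => ?_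
  have hprime := isPrime_map_of_polynomialExtension
    (f := (rename (Subtype.val : {i : Fin r // i ∉ σ} → Fin r) : _ →ₐ[K] _).toRingHom) he hq
  refine (Submonoid.closure_le (S := Ideal.primeCompl _)).2 ?_ hw
  rintro _ ⟨i, hi, rfl⟩ hmem
  have h := (mem_map_iff_coeff_mem
    (f := (rename (Subtype.val : {i : Fin r // i ∉ σ} → Fin r) : _ →ₐ[K] _).toRingHom)
    he).1 hmem (Finsupp.single ⟨i, hi⟩ 1)
  rw [heX ⟨i, hi⟩, coeff_X, if_pos rfl] at h
  exact hq.ne_top ((Ideal.eq_top_iff_one _).2 h)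

/-- Extension of a degree `α` on the complement of `σ` by `-1` on `σ`. -/
def extendDegree {r : ℕ} (σ : Finset (Fin r)) (α : {i : Fin r // i ∉ σ} → ℤ) (i : Fin r) : ℤ :=
  if h : i ∈ σ then -1 else α ⟨i, h⟩

section ExtendDegree

variable {r : ℕ} {σ : Finset (Fin r)} {α : {i : Fin r // i ∉ σ} → ℤ}

theorem extendDegree_coe (i : {i : Fin r // i ∉ σ}) : extendDegree σ α i = α i :=
  dif_neg i.2

theorem extendDegree_of_mem {i : Fin r} (h : i ∈ σ) : extendDegree σ α i = -1 :=
  dif_pos h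

theorem negSupport_extendDegree :
    negSupport (extendDegree σ α) =
      (negSupport α).map (Function.Embedding.subtype _) ∪ σ := by
  ext i
  by_cases h : i ∈ σ
  · simp [negSupport, h, extendDegree_of_mem h]
  · have hneg : extendDegree σ α i = α ⟨i, h⟩ := dif_neg h
    simp [negSupport, h, hneg]

theorem disjoint_map_subtype (F : Finset {i : Fin r // i ∉ σ}) :
    Disjoint (F.map (Function.Embedding.subtype _)) σ := by
  rw [Finset.disjoint_left]
  intro i hi
  obtain ⟨j, -, rfl⟩ := Finset.mem_map.1 hi
  exact j.2

theorem card_negSupport_extendDegree :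
    (negSupport (extendDegree σ α)).card = (negSupport α).card + σ.card := by
  rw [negSupport_extendDegree, Finset.card_union_of_disjoint (disjoint_map_subtype _),
    Finset.card_map]

theorem sum_extendDegree : ∑ i, extendDegree σ α i = (∑ i, α i) - σ.card := by
  rw [← Fintype.sum_subtype_add_sum_subtype (· ∈ σ), Finset.sum_congr rfl
    fun i _ => extendDegree_of_mem i.2, Finset.sum_congr rfl fun i _ => extendDegree_coe i]
  simp
  ring

theorem rename_monomial_toNat (K : Type*) [Field K] :
    rename Subtype.val (monomial (Finsupp.equivFunOnFinite.symm fun i => (α i).toNat) (1 : K)) =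
      monomial (Finsupp.equivFunOnFinite.symm fun i => (extendDegree σ α i).toNat) (1 : K) := by
  rw [rename_monomial]
  refine congrArg (fun d => monomial d (1 : K)) (Finsupp.ext fun i => ?_)
  by_cases h : i ∈ σ
  · rw [Finsupp.mapDomain_of_notMem_range]
    · simp [extendDegree_of_mem h]
    · simpa using h
  · have := Finsupp.mapDomain_apply Subtype.val_injective
      (Finsupp.equivFunOnFinite.symm fun i => (α i).toNat) (⟨i, h⟩ : {i : Fin r // i ∉ σ})
    rw [this]
    simp [extendDegree, h]

theorem prod_X_map_union_negSupport_extendDegree (K : Type*) [Field K]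
    [DecidableEq {i : Fin r // i ∉ σ}] (F : Finset {i : Fin r // i ∉ σ}) :
    ∏ i ∈ F.map (Function.Embedding.subtype _) ∪ negSupport (extendDegree σ α),
        (X i : MvPolynomial (Fin r) K) =
      rename Subtype.val (∏ i ∈ F ∪ negSupport α, X i : SmallPolyRing K σ) *
        ∏ i ∈ σ, X i := by
  rw [negSupport_extendDegree, ← Finset.union_assoc, ← Finset.map_union,
    Finset.prod_union (disjoint_map_subtype _), Finset.prod_map, map_prod]
  simp

theorem degreeComplex_extendDegree (K : Type*) [Field K] (Δ : FaceSet (Fin r)) (n : ℕ) :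
    degreeComplex K (symbolicPower (srIdeal K Δ) n) (extendDegree σ α) =
      Finset.map (Function.Embedding.subtype _) ''
        degreeComplex K (symbolicPower (restrictedIdeal K σ (srIdeal K Δ)) n) α := by
  have hmem : ∀ F : Finset {i : Fin r // i ∉ σ},
      F.map (Function.Embedding.subtype _) ∈
        degreeComplex K (symbolicPower (srIdeal K Δ) n) (extendDegree σ α) ↔
      F ∈ degreeComplex K (symbolicPower (restrictedIdeal K σ (srIdeal K Δ)) n) α := by
    intro F
    refine and_congr ?_ (not_congr ?_)
    · rw [Finset.forall_mem_map]
      exact forall₂_congr fun i _ => by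
        rw [Function.Embedding.subtype_apply, extendDegree_coe]
    · have hprod := @prod_X_map_union_negSupport_extendDegree r σ α K _
        LinearOrder.toDecidableEq F
      simp only [mem_symbolicPower_restrictedIdeal, hprod, ← rename_monomial_toNat, map_mul,
        map_pow, mul_pow]
      exact exists_mul_pow_mem_iff_exists_closure
  ext F
  constructor
  · intro hF
    have hFσ : (F.subtype (· ∉ σ)).map (Function.Embedding.subtype _) = F := by
      refine Finset.subtype_map_of_mem fun i hi hiσ => ?_
      have := hF.1 i hi
      rw [extendDegree_of_mem hiσ] at this
      omega
    exact ⟨_, (hmem _).1 (by rwa [hFσ]), hFσ⟩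
  · rintro ⟨F, hF, rfl⟩
    exact (hmem F).2 hF

end ExtendDegree

theorem reg_symbolicPower_restrictedIdeal_le (K : Type*) [Field K] {r : ℕ}
    (Δ : FaceSet (Fin r)) (σ : Finset (Fin r)) (n : ℕ) :
    reg K (symbolicPower (restrictedIdeal K σ (srIdeal K Δ)) n) ≤
      reg K (symbolicPower (srIdeal K Δ) n) := by
  refine reg_le_reg_of_lcNonzero K fun i α hα => ⟨i + σ.card, extendDegree σ α, ?_, ?_⟩
  · have hk : ((i + σ.card : ℕ) : ℤ) - (negSupport (extendDegree σ α)).card - 1 =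
        i - (negSupport α).card - 1 := by
      rw [card_negSupport_extendDegree]
      push_cast
      ring
    unfold lcNonzero at hα ⊢
    rw [degreeComplex_extendDegree, hk]
    exact hα.image_map fun _ _ h => h
  · rw [sum_extendDegree]
    push_cast
    ring

/-- Let `I` be a square-free monomial ideal of `R = K[x_1, …, x_r]`,
`σ ⊊ {1, …, r}`, `S = K[x_i : i ∉ σ]` and `J = I·R_σ ∩ S`. Then
`reg(J^{(n)}) ≤ reg(I^{(n)})` for all `n ≥ 1`, and consequently `δ(J) ≤ δ(I)`. -/
theorem statement6 {K : Type*} [Field K] {r : ℕ}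
    (I : Ideal (MvPolynomial (Fin r) K))
    (hI : ∃ Δ : FaceSet (Fin r), IsSimplicialComplex Δ ∧ I = srIdeal K Δ)
    (σ : Finset (Fin r)) (hσ : σ ≠ Finset.univ)
    (δI δJ : ℝ)
    (hδI : Filter.Tendsto (fun n : ℕ => (reg K (symbolicPower I n) : ℝ) / n)
      Filter.atTop (nhds δI))
    (hδJ : Filter.Tendsto
      (fun n : ℕ => (reg K (symbolicPower (restrictedIdeal K σ I) n) : ℝ) / n)
      Filter.atTop (nhds δJ)) :
    (∀ n : ℕ, 1 ≤ n →
      reg K (symbolicPower (restrictedIdeal K σ I) n) ≤ reg K (symbolicPower I n)) ∧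
    δJ ≤ δI := by
  obtain ⟨Δ, -, rfl⟩ := hI
  have hreg := reg_symbolicPower_restrictedIdeal_le K Δ σ
  refine ⟨fun n _ => hreg n, le_of_tendsto_of_tendsto' hδJ hδI fun n => ?_⟩
  exact div_le_div_of_nonneg_right (by exact_mod_cast hreg n) n.cast_nonneg
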